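/- For every integer k ≥ 3 and every u ∈ W_{k−1}^(2)(T), the weak divergence of the weak curl of u vanishes: ∇_w·(∇_w×u) = 0 in W_{k−3}^(4)(T). -/

import Mathlib

set_option linter.unusedVariables false

open MeasureTheory MvPolynomial
open scoped BigOperators

noncomputable section

/-- Euclidean 3-space. -/
abbrev E3 : Type := EuclideanSpace ℝ (Fin 3)

/-- Build a vector of `E3` from its three coordinates. -/
def toE3 (a : Fin 3 → ℝ) : E3 := (WithLp.equiv 2 (Fin 3 → ℝ)).symm a

/-- Euclidean dot product on `E3`. -/
def dot3 (a b : E3) : ℝ := ∑ i, a i * b i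

/-- Cross product on `E3`. -/
def cross3 (a b : E3) : E3 :=
  toE3 ![a 1 * b 2 - a 2 * b 1, a 2 * b 0 - a 0 * b 2, a 0 * b 1 - a 1 * b 0]

/-- Polynomials in three variables with real coefficients. -/
abbrev Poly3 := MvPolynomial (Fin 3) ℝ

/-- Evaluation of a polynomial at a point of `E3`. -/
def pev (p : Poly3) (x : E3) : ℝ := MvPolynomial.eval (fun i => x i) p

/-- Evaluation of a polynomial vector field at a point of `E3`. -/
def pevV (φ : Fin 3 → Poly3) (x : E3) : E3 := toE3 fun i => pev (φ i) x

/-- Divergence of a polynomial vector field. -/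
def divP (φ : Fin 3 → Poly3) : Poly3 := ∑ i, pderiv i (φ i)

/-- Gradient of a polynomial. -/
def gradP (p : Poly3) : Fin 3 → Poly3 := fun i => pderiv i p

/-- Curl of a polynomial vector field. -/
def curlP (φ : Fin 3 → Poly3) : Fin 3 → Poly3 :=
  ![pderiv 1 (φ 2) - pderiv 2 (φ 1),
    pderiv 2 (φ 0) - pderiv 0 (φ 2),
    pderiv 0 (φ 1) - pderiv 1 (φ 0)]

/-- The `i`-th standard basis vector of `E3`. -/
def basE (i : Fin 3) : E3 := EuclideanSpace.single i 1

/-- Gradient of a scalar function on `E3`. -/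
def gradF (v : E3 → ℝ) (x : E3) : E3 := toE3 fun i => fderiv ℝ v x (basE i)

/-- Divergence of a vector field on `E3`. -/
def divF (u : E3 → E3) (x : E3) : ℝ := ∑ i, fderiv ℝ u x (basE i) i

/-- Curl of a vector field on `E3`. -/
def curlF (u : E3 → E3) (x : E3) : E3 :=
  toE3 ![fderiv ℝ u x (basE 1) 2 - fderiv ℝ u x (basE 2) 1,
         fderiv ℝ u x (basE 2) 0 - fderiv ℝ u x (basE 0) 2,
         fderiv ℝ u x (basE 0) 1 - fderiv ℝ u x (basE 1) 0]

/-- A (shape-regular) polyhedron `T ⊂ ℝ³`, together with its faces, edges, vertices,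
unit outward normals `n_f`, right-handed tangent frames `(t_{f,1}, t_{f,2}, n_f)` on faces,
unit tangents `t_e` on edges, the orientation signs giving `t_{∂f}` on each boundary edge of a
face and `t_e · n_{∂e}` at the endpoints of each edge, and the basic geometric and
measure-theoretic properties of these data (faces carry the 2-dimensional Hausdorff measure,
edges the 1-dimensional one; the `L²` pairing of polynomials on `T`, on each face and on each
edge is positive definite). -/
structure Polyhedron3 (ιF ιE ιV : Type) [Fintype ιF] [Fintype ιE] [Fintype ιV] where
  carrier : Set E3
  face : ιF → Set E3
  edge : ιE → Set E3
  vtx : ιV → E3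
  nrm : ιF → E3
  tf1 : ιF → E3
  tf2 : ιF → E3
  te : ιE → E3
  faceEdges : ιF → Finset ιE
  sgn : ιF → ιE → ℝ
  edgeVtx : ιE → Fin 2 → ιV
  epsE : ιE → Fin 2 → ℝ
  carrier_bounded : Bornology.IsBounded carrier
  carrier_meas : MeasurableSet carrier
  interior_nonempty : (interior carrier).Nonempty
  face_meas : ∀ f, MeasurableSet (face f)
  edge_meas : ∀ e, MeasurableSet (edge e)
  face_fin : ∀ f, μH[2] (face f) ≠ ⊤
  edge_fin : ∀ e, μH[1] (edge e) ≠ ⊤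
  nrm_unit : ∀ f, dot3 (nrm f) (nrm f) = 1
  tf1_unit : ∀ f, dot3 (tf1 f) (tf1 f) = 1
  tf2_unit : ∀ f, dot3 (tf2 f) (tf2 f) = 1
  tf_orth : ∀ f, dot3 (tf1 f) (tf2 f) = 0
  rh_rule : ∀ f, nrm f = cross3 (tf1 f) (tf2 f)
  te_unit : ∀ e, dot3 (te e) (te e) = 1
  sgn_pm : ∀ f, ∀ e ∈ faceEdges f, sgn f e = 1 ∨ sgn f e = -1
  sgn_zero : ∀ f, ∀ e, e ∉ faceEdges f → sgn f e = 0
  epsE_pm : ∀ e j, epsE e j = 1 ∨ epsE e j = -1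
  epsE_opp : ∀ e, epsE e 0 + epsE e 1 = 0
  edge_seg : ∀ e, edge e = segment ℝ (vtx (edgeVtx e 0)) (vtx (edgeVtx e 1))
  edge_dir : ∀ e, ∃ c : ℝ, vtx (edgeVtx e 1) - vtx (edgeVtx e 0) = c • te e
  face_in_closure : ∀ f, face f ⊆ closure carrier
  edge_in_face : ∀ f, ∀ e ∈ faceEdges f, edge e ⊆ closure (face f)
  face_planar : ∀ f, ∀ x ∈ face f, ∀ y ∈ face f, dot3 (x - y) (nrm f) = 0
  edge_orient_cancel : ∀ e : ιE, ∑ f, sgn f e = 0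
  vol_nondeg : ∀ p : Poly3,
    (∫ x in carrier, (pev p x) ^ 2) = 0 → ∀ x ∈ carrier, pev p x = 0
  face_nondeg : ∀ f, ∀ p : Poly3,
    (∫ x in face f, (pev p x) ^ 2 ∂μH[2]) = 0 → ∀ x ∈ face f, pev p x = 0
  edge_nondeg : ∀ e, ∀ p : Poly3,
    (∫ x in edge e, (pev p x) ^ 2 ∂μH[1]) = 0 → ∀ x ∈ edge e, pev p x = 0

/-- An element of a WG space of type (1): a polynomial `v_0` on `T`, a polynomial `v_f` on each
face, a polynomial `v_e` on each edge and a real number `v_n` at each vertex. -/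
structure WGFun1 (ιF ιE ιV : Type) where
  v0 : Poly3
  vf : ιF → Poly3
  ve : ιE → Poly3
  vn : ιV → ℝ

/-- An element of a WG space of type (2): a polynomial vector field `u_0` on `T`, a tangential
polynomial field `u_f = u_1 t_{f,1} + u_2 t_{f,2}` on each face (recorded by the coefficient
pair `(u_1, u_2)`) and a tangential polynomial field `u_e = u t_e` on each edge (recorded by the
coefficient `u`). -/
structure WGFun2 (ιF ιE : Type) where
  u0 : Fin 3 → Poly3
  uf : ιF → Poly3 × Poly3
  ue : ιE → Poly3

/-- An element of a WG space of type (3): a polynomial vector field `w_0` on `T` and a normal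
polynomial field `w_f n_f` on each face (recorded by the coefficient `w_f`). -/
structure WGFun3 (ιF : Type) where
  w0 : Fin 3 → Poly3
  wf : ιF → Poly3

variable {ιF ιE ιV : Type} [Fintype ιF] [Fintype ιE] [Fintype ιV]

/-- The tangential vector field `u_1 t_{f,1} + u_2 t_{f,2}` on the face `f`. -/
def fvec (P : Polyhedron3 ιF ιE ιV) (f : ιF) (q : Poly3 × Poly3) (x : E3) : E3 :=
  pev q.1 x • P.tf1 f + pev q.2 x • P.tf2 f

/-- The tangential field `u_1 t_{f,1} + u_2 t_{f,2}` on `f` as a polynomial vector field. -/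
def fpoly (P : Polyhedron3 ιF ιE ιV) (f : ιF) (q : Poly3 × Poly3) : Fin 3 → Poly3 :=
  fun i => q.1 * MvPolynomial.C (P.tf1 f i) + q.2 * MvPolynomial.C (P.tf2 f i)

/-- `G0` is (a representative of) the weak gradient `∇_{w,0} v` on the volume `T`, relative to
the test space `[P_{kt}(T)]³`:
`(∇_{w,0}v, φ)_T = −(v_0, ∇·φ)_T + (v_f, φ·n)_{∂T}` for all test fields `φ`. -/
def IsWeakGrad0 (P : Polyhedron3 ιF ιE ιV) (kt : ℕ) (v : WGFun1 ιF ιE ιV)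
    (G0 : Fin 3 → Poly3) : Prop :=
  ∀ φ : Fin 3 → Poly3, (∀ i, (φ i).totalDegree ≤ kt) →
    (∫ x in P.carrier, dot3 (pevV G0 x) (pevV φ x)) =
      -(∫ x in P.carrier, pev v.v0 x * pev (divP φ) x) +
        ∑ f, ∫ x in P.face f, pev (v.vf f) x * dot3 (pevV φ x) (P.nrm f) ∂μH[2]

/-- `Gf` is (a representative of) the surface weak gradient `∇_{w,f} v` on the face `f`,
relative to the tangential test space of degree `kt`:
`(∇_{w,f}v, θ×n_f)_f = −(v_f, (∇×θ)·n_f)_f + (v_e, θ·t_{∂f})_{∂f}` for all test fields `θ`. -/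
def IsWeakGradF (P : Polyhedron3 ιF ιE ιV) (kt : ℕ) (v : WGFun1 ιF ιE ιV)
    (f : ιF) (Gf : Poly3 × Poly3) : Prop :=
  ∀ θ : Poly3 × Poly3, θ.1.totalDegree ≤ kt → θ.2.totalDegree ≤ kt →
    (∫ x in P.face f, dot3 (fvec P f Gf x) (cross3 (fvec P f θ x) (P.nrm f)) ∂μH[2]) =
      -(∫ x in P.face f,
          pev (v.vf f) x * dot3 (pevV (curlP (fpoly P f θ)) x) (P.nrm f) ∂μH[2]) +
        ∑ e ∈ P.faceEdges f,
          ∫ x in P.edge e, pev (v.ve e) x * dot3 (fvec P f θ x) (P.sgn f e • P.te e) ∂μH[1]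

/-- `Ge` is (a representative of) the edge weak gradient (directional derivative)
`∇_{w,e} v = Ge t_e` on the edge `e`, relative to the test space of degree `kt`:
`(∇_{w,e}v, φ t_e)_e = −(v_e, ∇φ·t_e)_e + (v_n, φ t_e·n_{∂e})_{∂e}` for all test `φ`. -/
def IsWeakGradE (P : Polyhedron3 ιF ιE ιV) (kt : ℕ) (v : WGFun1 ιF ιE ιV)
    (e : ιE) (Ge : Poly3) : Prop :=
  ∀ ψ : Poly3, ψ.totalDegree ≤ kt →
    (∫ x in P.edge e, dot3 (pev Ge x • P.te e) (pev ψ x • P.te e) ∂μH[1]) =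
      -(∫ x in P.edge e, pev (v.ve e) x * dot3 (pevV (gradP ψ) x) (P.te e) ∂μH[1]) +
        ∑ j : Fin 2, v.vn (P.edgeVtx e j) * (pev ψ (P.vtx (P.edgeVtx e j)) * P.epsE e j)

/-- `C0` is (a representative of) the weak curl `∇_{w,0} × u` on the volume `T`, relative to the
test space `[P_{kt}(T)]³`:
`(∇_{w,0}×u, θ)_T = (u_0, ∇×θ)_T + (u_f, θ×n)_{∂T}` for all test fields `θ`. -/
def IsWeakCurl0 (P : Polyhedron3 ιF ιE ιV) (kt : ℕ) (u : WGFun2 ιF ιE)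
    (C0 : Fin 3 → Poly3) : Prop :=
  ∀ θ : Fin 3 → Poly3, (∀ i, (θ i).totalDegree ≤ kt) →
    (∫ x in P.carrier, dot3 (pevV C0 x) (pevV θ x)) =
      (∫ x in P.carrier, dot3 (pevV u.u0 x) (pevV (curlP θ) x)) +
        ∑ f, ∫ x in P.face f, dot3 (fvec P f (u.uf f) x) (cross3 (pevV θ x) (P.nrm f)) ∂μH[2]

/-- `Cf` is (a representative of) the surface weak curl `∇_{w,f} × u = Cf n_f` on the face `f`,
relative to the normal test space of degree `kt`:
`(∇_{w,f}×u, τ n_f)_f = (u_f, ∇τ×n_f)_f + (u_e, τ t_{∂f})_{∂f}` for all test `τ`. -/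
def IsWeakCurlF (P : Polyhedron3 ιF ιE ιV) (kt : ℕ) (u : WGFun2 ιF ιE)
    (f : ιF) (Cf : Poly3) : Prop :=
  ∀ τ : Poly3, τ.totalDegree ≤ kt →
    (∫ x in P.face f, dot3 (pev Cf x • P.nrm f) (pev τ x • P.nrm f) ∂μH[2]) =
      (∫ x in P.face f,
          dot3 (fvec P f (u.uf f) x) (cross3 (pevV (gradP τ) x) (P.nrm f)) ∂μH[2]) +
        ∑ e ∈ P.faceEdges f,
          ∫ x in P.edge e,
            dot3 (pev (u.ue e) x • P.te e) (pev τ x • (P.sgn f e • P.te e)) ∂μH[1]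

/-- `D` is (a representative of) the weak divergence `∇_w · w` on `T`, relative to the test
space `P_{kt}(T)`: `(∇_w·w, τ)_T = −(w_0, ∇τ)_T + (w_f, τ n)_{∂T}` for all test `τ`. -/
def IsWeakDiv (P : Polyhedron3 ιF ιE ιV) (kt : ℕ) (w : WGFun3 ιF) (D : Poly3) : Prop :=
  ∀ τ : Poly3, τ.totalDegree ≤ kt →
    (∫ x in P.carrier, pev D x * pev τ x) =
      -(∫ x in P.carrier, dot3 (pevV w.w0 x) (pevV (gradP τ) x)) +
        ∑ f, ∫ x in P.face f, dot3 (pev (w.wf f) x • P.nrm f) (pev τ x • P.nrm f) ∂μH[2]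

/-- `q` is the `L²(T)` projection of `g` onto `P_k(T)`. -/
def IsL2ProjVol (P : Polyhedron3 ιF ιE ιV) (k : ℕ) (g : E3 → ℝ) (q : Poly3) : Prop :=
  q.totalDegree ≤ k ∧ ∀ p : Poly3, p.totalDegree ≤ k →
    (∫ x in P.carrier, (pev q x - g x) * pev p x) = 0

/-- `q` is the `L²(f)` projection of `g` onto `P_k(f)`. -/
def IsL2ProjFace (P : Polyhedron3 ιF ιE ιV) (k : ℕ) (f : ιF) (g : E3 → ℝ) (q : Poly3) : Prop :=
  q.totalDegree ≤ k ∧ ∀ p : Poly3, p.totalDegree ≤ k →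
    (∫ x in P.face f, (pev q x - g x) * pev p x ∂μH[2]) = 0

/-- `q` is the `L²(e)` projection of `g` onto `P_k(e)`. -/
def IsL2ProjEdge (P : Polyhedron3 ιF ιE ιV) (k : ℕ) (e : ιE) (g : E3 → ℝ) (q : Poly3) : Prop :=
  q.totalDegree ≤ k ∧ ∀ p : Poly3, p.totalDegree ≤ k →
    (∫ x in P.edge e, (pev q x - g x) * pev p x ∂μH[1]) = 0

/-- `q` is the `L²(T)` projection of the vector field `g` onto `[P_k(T)]³`. -/
def IsL2ProjVolV (P : Polyhedron3 ιF ιE ιV) (k : ℕ) (g : E3 → E3)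
    (q : Fin 3 → Poly3) : Prop :=
  (∀ i, (q i).totalDegree ≤ k) ∧ ∀ φ : Fin 3 → Poly3, (∀ i, (φ i).totalDegree ≤ k) →
    (∫ x in P.carrier, dot3 (pevV q x - g x) (pevV φ x)) = 0

/-- `q` records the `L²(f)` projection of the vector field `g` onto the tangential space
`V_{k,f}^{(2)}(f) = {u_1 t_{f,1} + u_2 t_{f,2}}`. -/
def IsL2ProjFaceTan (P : Polyhedron3 ιF ιE ιV) (k : ℕ) (f : ιF) (g : E3 → E3)
    (q : Poly3 × Poly3) : Prop :=
  q.1.totalDegree ≤ k ∧ q.2.totalDegree ≤ k ∧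
    ∀ θ : Poly3 × Poly3, θ.1.totalDegree ≤ k → θ.2.totalDegree ≤ k →
      (∫ x in P.face f, dot3 (fvec P f q x - g x) (fvec P f θ x) ∂μH[2]) = 0

/-- `q` records the `L²(e)` projection of the vector field `g` onto the tangential space
`V_{k,e}^{(2)}(e) = {u t_e}`. -/
def IsL2ProjEdgeTan (P : Polyhedron3 ιF ιE ιV) (k : ℕ) (e : ιE) (g : E3 → E3)
    (q : Poly3) : Prop :=
  q.totalDegree ≤ k ∧ ∀ ψ : Poly3, ψ.totalDegree ≤ k →
    (∫ x in P.edge e, dot3 (pev q x • P.te e - g x) (pev ψ x • P.te e) ∂μH[1]) = 0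

/-- `q` records the `L²(f)` projection of the vector field `g` onto the normal space
`V_{k,f}^{(3)}(f) = {w n_f}`. -/
def IsL2ProjFaceNrm (P : Polyhedron3 ιF ιE ιV) (k : ℕ) (f : ιF) (g : E3 → E3)
    (q : Poly3) : Prop :=
  q.totalDegree ≤ k ∧ ∀ τ : Poly3, τ.totalDegree ≤ k →
    (∫ x in P.face f, dot3 (pev q x • P.nrm f - g x) (pev τ x • P.nrm f) ∂μH[2]) = 0


/-- Partial derivatives of a polynomial commute. -/
lemma pderiv_swap (i j : Fin 3) (p : Poly3) :
    pderiv i (pderiv j p) = pderiv j (pderiv i p) := by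
  have h : ⁅(pderiv i : Derivation ℝ Poly3 Poly3), (pderiv j : Derivation ℝ Poly3 Poly3)⁆ = 0 := by
    apply MvPolynomial.derivation_ext
    intro l
    rw [Derivation.commutator_apply]
    simp only [pderiv_X, Derivation.zero_apply]
    have hc : ∀ a b : Fin 3, pderiv a (Pi.single (M := fun _ => Poly3) b 1 l) = 0 := by
      intro a b
      rw [Pi.single_apply]
      split_ifs <;> simp
    rw [hc, hc, sub_zero]
  have h2 := congrArg (fun d : Derivation ℝ Poly3 Poly3 => d p) h
  simp only [Derivation.commutator_apply, Derivation.zero_apply] at h2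
  exact sub_eq_zero.mp h2

/-- A partial derivative does not raise the total degree. -/
lemma totalDegree_pderiv_le' (i : Fin 3) (p : Poly3) :
    (pderiv i p).totalDegree ≤ p.totalDegree := by
  classical
  conv_lhs => rw [p.as_sum, map_sum]
  refine MvPolynomial.totalDegree_finsetSum_le ?_
  intro s hs
  rw [pderiv_monomial]
  refine (MvPolynomial.totalDegree_monomial_le _ _).trans ?_
  refine le_trans ?_ (MvPolynomial.le_totalDegree hs)
  have hle : s - Finsupp.single i 1 ≤ s := tsub_le_self
  rw [Finsupp.sum_fintype _ _ (fun _ => rfl), Finsupp.sum_fintype _ _ (fun _ => rfl)]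
  exact Finset.sum_le_sum fun j _ => hle j

/-- The curl of a gradient vanishes. -/
lemma curlP_gradP (p : Poly3) : curlP (gradP p) = 0 := by
  funext i
  fin_cases i <;> simp [curlP, gradP, pderiv_swap 1 0 p, pderiv_swap 2 0 p, pderiv_swap 2 1 p]

/-- **WG de Rham Complex 2, second complex property.**
For every integer `k ≥ 3` and every `u ∈ W_{k-1}^{(2)}(T)` on a shape-regular polyhedron `T`,
the weak divergence of the weak curl of `u` vanishes: `∇_w·(∇_w×u) = 0` in `W_{k-3}^{(4)}(T)`. -/
theorem weak_div_of_weak_curl_eq_zero_descending_order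
    {ιF ιE ιV : Type} [Fintype ιF] [Fintype ιE] [Fintype ιV]
    (P : Polyhedron3 ιF ιE ιV) (k : ℕ) (hk : 3 ≤ k)
    -- `u = {u_0, u_f, u_e} ∈ W_{k-1}^{(2)}(T)`
    (u : WGFun2 ιF ιE)
    (hu0 : ∀ i, (u.u0 i).totalDegree ≤ k - 1)
    (huf : ∀ f, (u.uf f).1.totalDegree ≤ k - 2 ∧ (u.uf f).2.totalDegree ≤ k - 2)
    (hue : ∀ e, (u.ue e).totalDegree ≤ k - 3)
    -- `∇_w×u = {∇_{w,0}×u, ∇_{w,f}×u} ∈ W_{k-2}^{(3)}(T)`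
    (C0 : Fin 3 → Poly3) (Cf : ιF → Poly3)
    (hC0d : ∀ i, (C0 i).totalDegree ≤ k - 2) (hCfd : ∀ f, (Cf f).totalDegree ≤ k - 3)
    (hC0 : IsWeakCurl0 P (k - 2) u C0)
    (hCf : ∀ f, IsWeakCurlF P (k - 3) u f (Cf f))
    -- `∇_w·(∇_w×u) ∈ W_{k-3}^{(4)}(T)`
    (D : Poly3) (hDd : D.totalDegree ≤ k - 3)
    (hD : IsWeakDiv P (k - 3) ⟨C0, Cf⟩ D) :
    ∀ x ∈ P.carrier, pev D x = 0 := by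
  apply P.vol_nondeg D
  have h1 := hD D hDd
  have h2 := hC0 (gradP D) (fun i => by
    have := totalDegree_pderiv_le' i D
    simp only [gradP]
    omega)
  have h3 := fun f => hCf f D hDd
  have hz : ∀ x, dot3 (pevV u.u0 x) (pevV (curlP (gradP D)) x) = 0 := by
    intro x
    simp [curlP_gradP, dot3, pevV, pev, toE3]
  simp only [hz, integral_zero, zero_add] at h2
  have h4 : ∀ f e,
      (∫ x in P.edge e,
        dot3 (pev (u.ue e) x • P.te e) (pev D x • (P.sgn f e • P.te e)) ∂μH[1]) =
      P.sgn f e * ∫ x in P.edge e,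
        dot3 (pev (u.ue e) x • P.te e) (pev D x • P.te e) ∂μH[1] := by
    intro f e
    rw [← integral_const_mul]
    congr 1
    funext x
    simp only [dot3, Finset.mul_sum, PiLp.smul_apply, smul_eq_mul]
    refine Finset.sum_congr rfl fun i _ => ?_
    ring
  have h5 : ∑ f, ∑ e ∈ P.faceEdges f,
      (∫ x in P.edge e,
        dot3 (pev (u.ue e) x • P.te e) (pev D x • (P.sgn f e • P.te e)) ∂μH[1]) = 0 := by
    simp only [h4]
    have h6 : ∀ f, ∑ e ∈ P.faceEdges f, P.sgn f e * (∫ x in P.edge e,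
        dot3 (pev (u.ue e) x • P.te e) (pev D x • P.te e) ∂μH[1]) =
        ∑ e, P.sgn f e * (∫ x in P.edge e,
        dot3 (pev (u.ue e) x • P.te e) (pev D x • P.te e) ∂μH[1]) := by
      intro f
      refine Finset.sum_subset (Finset.subset_univ _) fun e _ he => ?_
      rw [P.sgn_zero f e he, zero_mul]
    simp only [h6]
    rw [Finset.sum_comm]
    refine Finset.sum_eq_zero fun e _ => ?_
    rw [← Finset.sum_mul, P.edge_orient_cancel, zero_mul]
  simp only [h3, Finset.sum_add_distrib, h5, h2] at h1
  simp only [pow_two]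
  rw [h1]
  ring

end
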